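/- Let d ≥ 6 and n ≥ 9. For generic f ∈ S^d, generic linear form x ∈ S^1, and generic q ∈ R_f^{d-1} (each genericity meaning: on a nonempty Zariski-open subset), the multiplication map by q from R_f^{d+1}/xR_f^d to R_f^{2d}/xR_f^{2d-1} is injective. -/

import Mathlib

open MvPolynomial

noncomputable section

abbrev S (n : ℕ) : Type := MvPolynomial (Fin (n + 1)) ℂ

/-- The Jacobian ideal of `f`, generated by its partial derivatives. -/
def jacobianIdeal {n : ℕ} (f : S n) : Ideal (S n) :=
  Ideal.span (Set.range fun i => MvPolynomial.pderiv i f)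

/-- The degree-`k` graded piece of `S/I`: the image of the homogeneous degree-`k`
polynomials in the quotient. -/
def quotPiece {n : ℕ} (I : Ideal (S n)) (k : ℕ) : Submodule ℂ (S n ⧸ I) :=
  (MvPolynomial.homogeneousSubmodule (Fin (n + 1)) ℂ k).map
    (Ideal.Quotient.mkₐ ℂ I).toLinearMap

/-- The degree-`k` graded piece `R_f^k` of the Jacobian ring `R_f = S/J_f`. -/
def Rpiece {n : ℕ} (f : S n) (k : ℕ) : Submodule ℂ (S n ⧸ jacobianIdeal f) :=
  quotPiece (jacobianIdeal f) k

/-- `f` defines a smooth hypersurface: its partial derivatives have no common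
zero in `ℂ^{n+1} \ {0}`. -/
def SmoothHyp {n : ℕ} (f : S n) : Prop :=
  ∀ v : Fin (n + 1) → ℂ, (∀ i, MvPolynomial.eval v (MvPolynomial.pderiv i f) = 0) → v = 0

/-- A polynomial function on a complex vector space: an element of the algebra of
functions generated by the linear functionals. -/
def IsPolyFun {M : Type} [AddCommGroup M] [Module ℂ M] (φ : M → ℂ) : Prop :=
  φ ∈ Algebra.adjoin ℂ {ψ : M → ℂ | ∃ l : M →ₗ[ℂ] ℂ, ψ = ⇑l}

/-- A property `P` holds for generic points of `M`: it holds on a nonempty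
Zariski-open subset, i.e. on the nonvanishing locus of some polynomial function
that is not identically zero. -/
def GenericallyHolds {M : Type} [AddCommGroup M] [Module ℂ M] (P : M → Prop) : Prop :=
  ∃ φ : M → ℂ, IsPolyFun φ ∧ (∃ x, φ x ≠ 0) ∧ ∀ x, φ x ≠ 0 → P x

/-- Substitution of the linear change of coordinates given by the matrix `A`. -/
def substLin {n : ℕ} (A : Matrix (Fin (n + 1)) (Fin (n + 1)) ℂ) (f : S n) : S n :=
  MvPolynomial.aeval (fun i => ∑ j, A i j • MvPolynomial.X j) f

/-- A regular sequence: each `f i` is a nonzerodivisor modulo the previous ones. -/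
def IsRegularSeq {n c : ℕ} (f : Fin c → S n) : Prop :=
  ∀ (i : Fin c) (g : S n),
    f i * g ∈ Ideal.span (f '' {j | j < i}) → g ∈ Ideal.span (f '' {j | j < i})

/-- Zariski-closed subset of a complex vector space: common zero locus of a set of
polynomial functions. -/
def IsZariskiClosed {M : Type} [AddCommGroup M] [Module ℂ M] (T : Set M) : Prop :=
  ∃ 𝒮 : Set (M → ℂ), (∀ φ ∈ 𝒮, IsPolyFun φ) ∧ T = {x | ∀ φ ∈ 𝒮, φ x = 0}

/-- An irreducible Zariski-closed subset. -/
def IsIrredClosed {M : Type} [AddCommGroup M] [Module ℂ M] (Z : Set M) : Prop :=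
  IsZariskiClosed Z ∧ Z.Nonempty ∧
    ∀ C₁ C₂ : Set M, IsZariskiClosed C₁ → IsZariskiClosed C₂ →
      Z ⊆ C₁ ∪ C₂ → Z ⊆ C₁ ∨ Z ⊆ C₂

/-- The (Krull) dimension of the algebraic set `T` is at least `m`: there is a strictly
increasing chain of `m+1` irreducible closed subsets contained in `T`. -/
def algDimGE {M : Type} [AddCommGroup M] [Module ℂ M] (T : Set M) (m : ℕ) : Prop :=
  ∃ Z : Fin (m + 1) → Set M, StrictMono Z ∧ (∀ i, IsIrredClosed (Z i)) ∧
    Z (Fin.last m) ⊆ T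

/-- The ideal `J_f + (x)` of `S`; the degree-`k` piece of `S/(J_f + (x))` is
`R_f^k / x·R_f^{k-1}`. -/
def JX {n : ℕ} (f x : S n) : Ideal (S n) :=
  jacobianIdeal f ⊔ Ideal.span {x}

section Lefschetz

variable {K V : Type*} [Field K] [AddCommGroup V] [Module K V]

/-- A raising operator `E` and a lowering operator `F` on a graded family of subspaces `D`,
satisfying the `sl₂` commutation relation for a family centred at degree `s / 2`. -/
structure IsLefschetz (E F : Module.End K V) (D : ℕ → Submodule K V) (s : ℕ) : Prop where
  raise : ∀ {j v}, v ∈ D j → E v ∈ D (j + 1)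
  lower : ∀ {j v}, v ∈ D (j + 1) → F v ∈ D j
  lower_zero : ∀ {v}, v ∈ D 0 → F v = 0
  comm : ∀ {j v}, v ∈ D j → F (E v) = E (F v) + ((s : K) - 2 * j) • v

namespace IsLefschetz

variable {E F : Module.End K V} {D : ℕ → Submodule K V} {s : ℕ}

theorem pow_raise (h : IsLefschetz E F D s) {j : ℕ} {v : V} (hv : v ∈ D j) (k : ℕ) :
    (E ^ k) v ∈ D (j + k) := by
  induction k with
  | zero => simpa using hv
  | succ k ih =>
    rw [pow_succ', Module.End.mul_apply, ← add_assoc]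
    exact h.raise ih

theorem comm_pow (h : IsLefschetz E F D s) {j : ℕ} {v : V} (hv : v ∈ D j) (k : ℕ) :
    F ((E ^ (k + 1)) v) =
      (E ^ (k + 1)) (F v) + (((k : K) + 1) * ((s : K) - 2 * j - k)) • (E ^ k) v := by
  induction k with
  | zero => simpa using h.comm hv
  | succ k ih =>
    have hE (m : ℕ) (w : V) : E ((E ^ m) w) = (E ^ (m + 1)) w := by
      rw [pow_succ', Module.End.mul_apply]
    rw [← hE (k + 1) v, h.comm (h.pow_raise hv (k + 1)), ih, map_add, map_smul, hE, hE, add_assoc,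
      ← add_smul]
    congr 2
    push_cast
    ring

variable [CharZero K]

theorem eq_zero_of_primitive (h : IsLefschetz E F D s) {j : ℕ} {v : V} (hv : v ∈ D j)
    (hF : F v = 0) (k : ℕ) (hk : 2 * j + k ≤ s) (hE : (E ^ k) v = 0) : v = 0 := by
  induction k with
  | zero => simpa using hE
  | succ k ih =>
    refine ih (by omega) ?_
    have h1 := h.comm_pow hv k
    rw [hE, hF, map_zero, map_zero, zero_add] at h1
    refine (smul_eq_zero.mp h1.symm).resolve_left (mul_ne_zero (Nat.cast_add_one_ne_zero k) ?_)
    obtain ⟨c, hc⟩ := Nat.exists_eq_add_of_le hk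
    have : (s : K) - 2 * j - k = (c : K) + 1 := by rw [hc]; push_cast; ring
    rw [this]
    exact Nat.cast_add_one_ne_zero c

/-- The hard Lefschetz property: `E ^ k` is injective in degrees at most `(s - k) / 2`. -/
theorem eq_zero_of_pow_eq_zero (h : IsLefschetz E F D s) {j k : ℕ} (hk : 2 * j + k ≤ s) {v : V}
    (hv : v ∈ D j) (hE : (E ^ k) v = 0) : v = 0 := by
  induction j generalizing k v with
  | zero => exact h.eq_zero_of_primitive hv (h.lower_zero hv) k hk hE
  | succ j ih =>
    refine h.eq_zero_of_primitive hv (ih (k := k + 1) (by omega) (h.lower hv) ?_) k hk hE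
    have h1 := h.comm_pow hv k
    rwa [pow_succ', Module.End.mul_apply, hE, map_zero, map_zero, smul_zero, add_zero,
      ← Module.End.mul_apply, ← pow_succ', eq_comm] at h1

theorem raise_lower_add_smul (h : IsLefschetz E F D s) {j : ℕ} (hj : 2 * j ≤ s + 2) {c : ℕ}
    (hc : 0 < c) :
    (∀ y ∈ D j, ∃ t ∈ D j, E (F t) + (c : K) • t = y) ∧
      ∀ t ∈ D j, E (F t) + (c : K) • t = 0 → t = 0 := by
  induction j generalizing c with
  | zero =>
    have hc' : (c : K) ≠ 0 := Nat.cast_ne_zero.mpr hc.ne'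
    refine ⟨fun y hy => ⟨(c : K)⁻¹ • y, (D 0).smul_mem _ hy, ?_⟩, fun t ht h0 => ?_⟩
    · rw [h.lower_zero ((D 0).smul_mem _ hy), map_zero, zero_add, smul_inv_smul₀ hc']
    · rw [h.lower_zero ht, map_zero, zero_add] at h0
      exact (smul_eq_zero.mp h0).resolve_left hc'
  | succ j ih =>
    have hc' : (c : K) ≠ 0 := Nat.cast_ne_zero.mpr hc.ne'
    obtain ⟨r, rfl⟩ : ∃ r, s = 2 * j + r := Nat.exists_eq_add_of_le (by omega)
    obtain ⟨hsurj, hinj⟩ := ih (c := c + r) (by omega) (by omega)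
    have key {u : V} (hu : u ∈ D j) :
        E (F u) + ((c + r : ℕ) : K) • u = F (E u) + (c : K) • u := by
      rw [h.comm hu, add_assoc, ← add_smul]
      congr 2
      push_cast
      ring
    refine ⟨fun y hy => ?_, fun t ht h0 => ?_⟩
    · obtain ⟨u, hu, hu'⟩ := hsurj (F y) (h.lower hy)
      rw [key hu] at hu'
      refine ⟨(c : K)⁻¹ • (y - E u),
        (D (j + 1)).smul_mem _ ((D (j + 1)).sub_mem hy (h.raise hu)), ?_⟩
      have : F y - F (E u) = (c : K) • u := by rw [← hu']; abel
      rw [smul_inv_smul₀ hc', map_smul, map_smul, map_sub, this, map_smul, inv_smul_smul₀ hc']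
      abel
    · have hF : F t = 0 := by
        refine hinj _ (h.lower ht) ?_
        rw [key (h.lower ht), ← map_smul, ← map_add, h0, map_zero]
      rw [hF, map_zero, zero_add] at h0
      exact (smul_eq_zero.mp h0).resolve_left hc'

theorem exists_lower_raise_eq (h : IsLefschetz E F D s) {j : ℕ} (hj : 2 * j < s) {y : V}
    (hy : y ∈ D j) : ∃ t ∈ D j, F (E t) = y := by
  obtain ⟨r, rfl⟩ := Nat.exists_eq_add_of_le hj.le
  obtain ⟨t, ht, ht'⟩ := (h.raise_lower_add_smul (c := r) (by omega) (by omega)).1 y hy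
  refine ⟨t, ht, ?_⟩
  rw [h.comm ht, ← ht']
  congr 2
  push_cast
  ring

theorem eq_zero_of_lower_raise_eq_zero (h : IsLefschetz E F D s) {j : ℕ} (hj : 2 * j < s) {t : V}
    (ht : t ∈ D j) (h0 : F (E t) = 0) : t = 0 := by
  obtain ⟨r, rfl⟩ := Nat.exists_eq_add_of_le hj.le
  refine (h.raise_lower_add_smul (c := r) (by omega) (by omega)).2 t ht ?_
  rw [← h0, h.comm ht]
  congr 2
  push_cast
  ring

omit [CharZero K] in
theorem mapQ (h : IsLefschetz E F D s) (I : Submodule K V) (hE : I ≤ I.comap E)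
    (hF : I ≤ I.comap F) :
    IsLefschetz (I.mapQ I E hE) (I.mapQ I F hF) (fun j => (D j).map I.mkQ) s where
  raise := by
    rintro j _ ⟨v, hv, rfl⟩
    exact ⟨E v, h.raise hv, rfl⟩
  lower := by
    rintro j _ ⟨v, hv, rfl⟩
    exact ⟨F v, h.lower hv, rfl⟩
  lower_zero := by
    rintro _ ⟨v, hv, rfl⟩
    simp [h.lower_zero hv]
  comm := by
    rintro j _ ⟨v, hv, rfl⟩
    simp only [Submodule.mkQ_apply, Submodule.mapQ_apply, h.comm hv]
    simp

end IsLefschetz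

/-- In a bigraded family carrying two commuting Lefschetz pairs, if `E₂ ^ k` carries an element of
total degree `k + 2` into the image of `E₁ + E₂`, then that element is already in this image. -/
theorem exists_sum_eq_of_pow_eq [CharZero K] {E₁ F₁ E₂ F₂ : Module.End K V}
    {D : ℕ → ℕ → Submodule K V} {s₁ s₂ k : ℕ} (h₁ : ∀ j, IsLefschetz E₁ F₁ (fun i => D i j) s₁)
    (h₂ : ∀ i, IsLefschetz E₂ F₂ (D i) s₂) (hE : Commute E₁ E₂) (hF : Commute F₁ E₂)
    (hs₁ : 3 * k + 4 ≤ s₁) (hs₂ : 3 * k + 4 ≤ s₂) {p v : ℕ → V}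
    (hp : ∀ i ≤ k + 2, p i ∈ D i (k + 2 - i)) (hp' : ∀ i, k + 2 < i → p i = 0)
    (hv : ∀ i ≤ 2 * k + 1, v i ∈ D i (2 * k + 1 - i)) (hv' : ∀ i, 2 * k + 1 < i → v i = 0)
    (h0 : (E₂ ^ k) (p 0) = E₂ (v 0))
    (hsucc : ∀ i, (E₂ ^ k) (p (i + 1)) = E₁ (v i) + E₂ (v (i + 1))) :
    ∃ t, ∑ i ∈ Finset.range (k + 3), p i = E₁ t + E₂ t := by
  have hcE (m : ℕ) (w : V) : (E₂ ^ m) (E₁ w) = E₁ ((E₂ ^ m) w) :=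
    LinearMap.congr_fun (hE.pow_right m).eq.symm w
  have hcE' (m : ℕ) (w : V) : (E₁ ^ m) (E₂ w) = E₂ ((E₁ ^ m) w) :=
    LinearMap.congr_fun (hE.pow_left m).eq w
  have hcF (m : ℕ) (w : V) : (E₂ ^ m) (F₁ w) = F₁ ((E₂ ^ m) w) :=
    LinearMap.congr_fun (hF.pow_right m).eq.symm w
  have hcE₂ (m : ℕ) (w : V) : (E₂ ^ m) (E₂ w) = E₂ ((E₂ ^ m) w) := by
    rw [← Module.End.mul_apply, ← pow_succ, pow_succ', Module.End.mul_apply]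
  have hinj₂ {i j : ℕ} {w : V} (hj : j ≤ k + 2) (hw : w ∈ D i j) (hw0 : (E₂ ^ k) w = 0) :
      w = 0 :=
    (h₂ i).eq_zero_of_pow_eq_zero (by omega) hw hw0
  have hnil (m : ℕ) (hm : m ≤ k) : (E₁ ^ m) (v (2 * k + 2 - m)) = 0 := by
    induction m with
    | zero => simp [hv' (2 * k + 2) (by omega)]
    | succ m ih =>
      have h1 := hsucc (2 * k + 2 - (m + 1))
      have e : 2 * k + 2 - (m + 1) + 1 = 2 * k + 2 - m := by omega
      rw [e, hp' _ (by omega), map_zero, eq_comm, add_eq_zero_iff_eq_neg] at h1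
      rw [pow_succ, Module.End.mul_apply, h1, map_neg, hcE', ih (by omega), map_zero, neg_zero]
  have hvtop : v (k + 2) = 0 := by
    by_cases hk : k = 0
    · exact hv' _ (by omega)
    · have h1 := hnil k le_rfl
      rw [show 2 * k + 2 - k = k + 2 by omega] at h1
      exact (h₁ _).eq_zero_of_pow_eq_zero (by omega) (hv (k + 2) (by omega)) h1
  have hdiv {i : ℕ} {w u : V} (hi : i ≤ k + 1) (hw : w ∈ D (i + 1) (k + 1 - i))
      (hu : u ∈ D i (2 * k + 1 - i)) (hwu : (E₂ ^ k) w = E₁ u) :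
      ∃ t ∈ D i (k + 1 - i), w = E₁ t ∧ u = (E₂ ^ k) t := by
    obtain ⟨t, ht, hFt⟩ :=
      (h₁ (k + 1 - i)).exists_lower_raise_eq (j := i) (by omega) ((h₁ _).lower hw)
    have ht' := (h₂ i).pow_raise ht k
    rw [show k + 1 - i + k = 2 * k + 1 - i by omega] at ht'
    have hu' : u - (E₂ ^ k) t = 0 := by
      refine (h₁ (2 * k + 1 - i)).eq_zero_of_lower_raise_eq_zero (j := i) (by omega)
        (Submodule.sub_mem _ hu ht') ?_
      rw [map_sub, map_sub, ← hwu, ← hcF, ← hcE, ← hcF, hFt, sub_self]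
    refine ⟨t, ht, ?_, sub_eq_zero.mp hu'⟩
    refine sub_eq_zero.mp (hinj₂ (j := k + 1 - i) (by omega)
      (Submodule.sub_mem _ hw ((h₁ (k + 1 - i)).raise ht)) ?_)
    rw [map_sub, hwu, hcE, ← map_sub, hu', map_zero]
  have hdesc (m i : ℕ) (hm : i + m = k + 2) : ∃ t z : V, E₂ t ∈ D i (k + 2 - i) ∧
      v i = (E₂ ^ k) t ∧ ∑ l ∈ Finset.Ico (i + 1) (k + 3), p l = E₁ t + (E₁ z + E₂ z) := by
    induction m generalizing i with
    | zero =>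
      obtain rfl : i = k + 2 := hm
      exact ⟨0, 0, by simp, by simpa using hvtop, by simp⟩
    | succ m ih =>
      obtain ⟨t, z, ht, hvt, hsum⟩ := ih (i + 1) (by omega)
      have hw : p (i + 1) - E₂ t ∈ D (i + 1) (k + 1 - i) := by
        have h1 := Submodule.sub_mem _ (hp (i + 1) (by omega)) ht
        rwa [show k + 2 - (i + 1) = k + 1 - i by omega] at h1
      obtain ⟨t', ht', hpt, hvt'⟩ := hdiv (u := v i) (by omega) hw (hv i (by omega)) (by
        rw [map_sub, hsucc, hvt, hcE₂, add_sub_cancel_right])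
      refine ⟨t', z + t, ?_, hvt', ?_⟩
      · rw [show k + 2 - i = k + 1 - i + 1 by omega]
        exact (h₂ i).raise ht'
      · rw [Finset.sum_eq_sum_Ico_succ_bot (by omega), hsum, ← sub_add_cancel (p (i + 1)) (E₂ t),
          hpt,
          map_add, map_add]
        abel
  obtain ⟨t, z, ht, hvt, hsum⟩ := hdesc (k + 2) 0 (by omega)
  have hp0 : p 0 = E₂ t := by
    refine sub_eq_zero.mp (hinj₂ (j := k + 2) le_rfl (Submodule.sub_mem _ (hp 0 (by omega)) ht) ?_)
    rw [map_sub, h0, hvt, hcE₂, sub_self]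
  refine ⟨t + z, ?_⟩
  rw [Finset.range_eq_Ico, Finset.sum_eq_sum_Ico_succ_bot (by omega), hsum, hp0, map_add, map_add]
  abel

end Lefschetz

section MonomialIdeal

variable {σ K : Type*} [Fintype σ] [DecidableEq σ] [Field K]

/-- The sum of the variables indexed by `T`. -/
def sumX (K : Type*) [Field K] (T : Finset σ) : MvPolynomial σ K := ∑ i ∈ T, X i

/-- The weight whose degree is the degree in the variables indexed by `T`. -/
def indWeight (T : Finset σ) : σ → ℕ := fun i => if i ∈ T then 1 else 0

/-- The ideal generated by the `a`-th powers of the variables indexed by `T`. -/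
def powIdeal (K : Type*) [Field K] (a : ℕ) (T : Finset σ) : Ideal (MvPolynomial σ K) :=
  Ideal.span ((fun i => X i ^ a) '' (T : Set σ))

/-- The differential operator that is adjoint to multiplication by `sumX K T` on the quotient
by the `(b + 1)`-st powers of the variables. -/
def lowering (K : Type*) [Field K] (b : ℕ) (T : Finset σ) : Module.End K (MvPolynomial σ K) :=
  ∑ i ∈ T, ((b : K) • (pderiv i).toLinearMap -
    LinearMap.mulLeft K (X i) ∘ₗ (pderiv i).toLinearMap ∘ₗ (pderiv i).toLinearMap)

omit [Fintype σ] [DecidableEq σ] in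
theorem lowering_apply (b : ℕ) (T : Finset σ) (p : MvPolynomial σ K) :
    lowering K b T p =
      ∑ i ∈ T, ((b : MvPolynomial σ K) * pderiv i p - X i * pderiv i (pderiv i p)) := by
  simp only [lowering, LinearMap.sum_apply]
  refine Finset.sum_congr rfl fun i _ => ?_
  simp [smul_eq_C_mul]

omit [Fintype σ] in
theorem pderiv_sumX (T : Finset σ) (i : σ) :
    pderiv i (sumX K T) = if i ∈ T then 1 else 0 := by
  simp only [sumX, map_sum, pderiv_X, Pi.single_apply]
  simp

omit [Fintype σ] [DecidableEq σ] in
theorem sumX_isWeightedHomogeneous_of_forall {T : Finset σ} {w : σ → ℕ} {m : ℕ}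
    (h : ∀ i ∈ T, w i = m) : (sumX K T).IsWeightedHomogeneous w m :=
  IsWeightedHomogeneous.sum _ _ _ fun i hi => h i hi ▸ isWeightedHomogeneous_X K w i

omit [Fintype σ] in
theorem sumX_isWeightedHomogeneous (T : Finset σ) :
    (sumX K T).IsWeightedHomogeneous (indWeight T) 1 :=
  sumX_isWeightedHomogeneous_of_forall fun i hi => by simp [indWeight, hi]

omit [Fintype σ] in
theorem sumX_isWeightedHomogeneous_of_disjoint {T U : Finset σ} (h : Disjoint T U) :
    (sumX K T).IsWeightedHomogeneous (indWeight U) 0 :=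
  sumX_isWeightedHomogeneous_of_forall fun i hi => by
    simp [indWeight, Finset.disjoint_left.mp h hi]

omit [Fintype σ] in
theorem lowering_sumX_mul_of_disjoint (b : ℕ) {T U : Finset σ} (h : Disjoint T U)
    (p : MvPolynomial σ K) : lowering K b T (sumX K U * p) = sumX K U * lowering K b T p := by
  simp only [lowering_apply, Finset.mul_sum]
  refine Finset.sum_congr rfl fun i hi => ?_
  have hU := Finset.disjoint_left.mp h hi
  simp only [Derivation.leibniz, pderiv_sumX, hU, if_false, smul_eq_mul, mul_zero, add_zero]
  ring

theorem lowering_sumX_mul (b : ℕ) (T : Finset σ) {p : MvPolynomial σ K} {j : ℕ}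
    (hp : p.IsWeightedHomogeneous (indWeight T) j) :
    lowering K b T (sumX K T * p) =
      sumX K T * lowering K b T p + (((b * T.card : ℕ) : K) - 2 * j) • p := by
  have heuler : ∑ i ∈ T, X i * pderiv i p = (j : MvPolynomial σ K) * p := by
    have h1 := hp.sum_weight_X_mul_pderiv
    simpa [indWeight, Finset.sum_ite_mem] using h1
  have hterm : ∀ i ∈ T, (b : MvPolynomial σ K) * pderiv i (sumX K T * p) -
      X i * pderiv i (pderiv i (sumX K T * p)) =
      sumX K T * ((b : MvPolynomial σ K) * pderiv i p - X i * pderiv i (pderiv i p)) +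
        ((b : MvPolynomial σ K) * p - 2 * (X i * pderiv i p)) := by
    intro i hi
    simp only [Derivation.leibniz, pderiv_sumX, hi, if_true, smul_eq_mul, mul_one, map_add]
    ring
  rw [lowering_apply, Finset.sum_congr rfl hterm, Finset.sum_add_distrib, ← Finset.mul_sum,
    ← lowering_apply, Finset.sum_sub_distrib, ← Finset.mul_sum, ← Finset.mul_sum, heuler,
    Finset.sum_const, smul_eq_C_mul]
  simp only [nsmul_eq_mul, map_sub, map_mul, map_natCast, map_ofNat]
  push_cast
  ring

omit [Fintype σ] [DecidableEq σ] in
theorem pderiv_eq_zero_of_isWeightedHomogeneous_zero {w : σ → ℕ} {p : MvPolynomial σ K}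
    (hp : p.IsWeightedHomogeneous w 0) {i : σ} (hi : w i ≠ 0) : pderiv i p = 0 := by
  refine pderiv_eq_zero_of_notMem_vars fun hmem => ?_
  obtain ⟨m, hm, him⟩ := (mem_vars_iff_mem_support i).mp hmem
  have h1 := Finsupp.le_weight w hi m
  rw [hp (mem_support_iff.mp hm)] at h1
  exact Finsupp.mem_support_iff.mp him (Nat.le_zero.mp h1)

theorem isLefschetz_sumX (b : ℕ) {T U : Finset σ} (hTU : Disjoint T U) (j : ℕ) :
    IsLefschetz (LinearMap.mulLeft K (sumX K T)) (lowering K b T)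
      (fun i => weightedHomogeneousSubmodule K (indWeight T) i ⊓
        weightedHomogeneousSubmodule K (indWeight U) j) (b * T.card) where
  raise := by
    rintro i p ⟨hp, hp'⟩
    refine ⟨?_, ?_⟩
    · rw [add_comm]
      exact (sumX_isWeightedHomogeneous T).mul hp
    · have := (sumX_isWeightedHomogeneous_of_disjoint (K := K) hTU).mul hp'
      rwa [zero_add] at this
  lower := by
    rintro i p ⟨hp, hp'⟩
    rw [lowering_apply]
    refine Submodule.sum_mem _ fun l hl => ?_
    have hlU := Finset.disjoint_left.mp hTU hl
    have hwT : indWeight T l = 1 := by simp [indWeight, hl]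
    have hwU : indWeight U l = 0 := by simp [indWeight, hlU]
    have hd : (pderiv l p).IsWeightedHomogeneous (indWeight T) i :=
      IsWeightedHomogeneous.pderiv hp (by rw [hwT])
    have hd' : (pderiv l p).IsWeightedHomogeneous (indWeight U) j :=
      IsWeightedHomogeneous.pderiv hp' (by rw [hwU, add_zero])
    have hdd' : (X l * pderiv l (pderiv l p)).IsWeightedHomogeneous (indWeight U) j := by
      have := (isWeightedHomogeneous_X K (indWeight U) l).mul
        (IsWeightedHomogeneous.pderiv hd' (by rw [hwU, add_zero]))
      rwa [hwU, zero_add] at this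
    have hdd : (X l * pderiv l (pderiv l p)).IsWeightedHomogeneous (indWeight T) i := by
      cases i with
      | zero =>
        rw [pderiv_eq_zero_of_isWeightedHomogeneous_zero hd (by simp [hwT]), mul_zero]
        exact isWeightedHomogeneous_zero _ _ _
      | succ i =>
        have := (isWeightedHomogeneous_X K (indWeight T) l).mul
          (IsWeightedHomogeneous.pderiv (n' := i) (i := l) hd (by rw [hwT]))
        rwa [hwT, add_comm] at this
    rw [← map_natCast (C : K →+* MvPolynomial σ K)]
    exact ⟨(hd.C_mul _).sub hdd, (hd'.C_mul _).sub hdd'⟩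
  lower_zero := by
    rintro p ⟨hp, -⟩
    rw [lowering_apply]
    refine Finset.sum_eq_zero fun l hl => ?_
    rw [pderiv_eq_zero_of_isWeightedHomogeneous_zero hp (by simp [indWeight, hl])]
    simp
  comm := by
    rintro i p ⟨hp, -⟩
    exact lowering_sumX_mul b T hp

end MonomialIdeal

section PowIdeal

variable {σ K : Type*} [Field K]

theorem mem_powIdeal_iff {a : ℕ} {T : Finset σ} {p : MvPolynomial σ K} :
    p ∈ powIdeal K a T ↔ ∀ m ∈ p.support, ∃ i ∈ T, a ≤ m i := by
  have h := @mem_ideal_span_monomial_image σ K _ p ((fun i => Finsupp.single i a) '' (T : Set σ))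
  rw [Set.image_image] at h
  simp only [X_pow_eq_monomial, powIdeal]
  refine h.trans (forall₂_congr fun m _ => ?_)
  simp [Finsupp.single_le_iff]

theorem mem_powIdeal_of_mul_X_pow_mem {a : ℕ} {T : Finset σ} {i : σ} (hi : i ∉ T)
    {p : MvPolynomial σ K} (hp : p * X i ^ a ∈ powIdeal K a T) : p ∈ powIdeal K a T := by
  classical
  rw [mem_powIdeal_iff] at hp ⊢
  intro m hm
  obtain ⟨j, hj, h⟩ := hp (m + Finsupp.single i a) (by
    rw [X_pow_eq_monomial, mem_support_iff, coeff_mul_monomial, mul_one]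
    exact mem_support_iff.mp hm)
  have hij : i ≠ j := fun h => hi (h ▸ hj)
  refine ⟨j, hj, ?_⟩
  simpa [Finsupp.single_apply, hij] using h

theorem isHomogeneous_powIdeal (w : σ → ℕ) (a : ℕ) (T : Finset σ) :
    letI := weightedGradedAlgebra K w
    (powIdeal K a T).IsHomogeneous (weightedHomogeneousSubmodule K w) := by
  let := weightedGradedAlgebra K w
  refine Ideal.homogeneous_span _ _ ?_
  rintro _ ⟨i, -, rfl⟩
  exact ⟨a • w i, (isWeightedHomogeneous_X K w i).pow a⟩

theorem weightedHomogeneousComponent_mem_powIdeal (w : σ → ℕ) {a : ℕ} {T : Finset σ}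
    {p : MvPolynomial σ K} (hp : p ∈ powIdeal K a T) (m : ℕ) :
    weightedHomogeneousComponent w m p ∈ powIdeal K a T :=
  weightedHomogeneousComponent_mem_of_mem K w (isHomogeneous_powIdeal w a T) hp m

theorem weightedHomogeneousComponent_mul_add {w : σ → ℕ} {e : ℕ} {g : MvPolynomial σ K}
    (hg : g.IsWeightedHomogeneous w e) (c : MvPolynomial σ K) (m : ℕ) :
    weightedHomogeneousComponent w (e + m) (g * c) = g * weightedHomogeneousComponent w m c := by
  let := weightedGradedAlgebra K w
  have := DirectSum.coe_decompose_mul_add_of_left_mem (weightedHomogeneousSubmodule K w)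
    (i := e) (j := m) (a := g) (b := c) hg
  erw [weightedDecomposition.decompose'_apply, weightedDecomposition.decompose'_apply] at this
  exact this

theorem weightedHomogeneousComponent_mul_of_lt {w : σ → ℕ} {e m : ℕ} {g : MvPolynomial σ K}
    (hg : g.IsWeightedHomogeneous w e) (c : MvPolynomial σ K) (hm : m < e) :
    weightedHomogeneousComponent w m (g * c) = 0 := by
  let := weightedGradedAlgebra K w
  have := DirectSum.coe_decompose_mul_of_left_mem_of_not_le (weightedHomogeneousSubmodule K w)
    (i := e) (n := m) (a := g) (b := c) hg hm.not_ge
  erw [weightedDecomposition.decompose'_apply] at this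
  exact this

theorem weightedHomogeneousComponent_mul_of_isWeightedHomogeneous_zero {w : σ → ℕ}
    {g : MvPolynomial σ K} (hg : g.IsWeightedHomogeneous w 0) (c : MvPolynomial σ K) (m : ℕ) :
    weightedHomogeneousComponent w m (g * c) = g * weightedHomogeneousComponent w m c := by
  simpa using weightedHomogeneousComponent_mul_add hg c m

theorem lowering_mem_powIdeal [Fintype σ] (b : ℕ) (T : Finset σ) {p : MvPolynomial σ K}
    (hp : p ∈ powIdeal K (b + 1) Finset.univ) :
    lowering K b T p ∈ powIdeal K (b + 1) Finset.univ := by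
  classical
  obtain ⟨c, rfl⟩ := (Submodule.mem_span_image_finset_iff_exists_fun' _).mp hp
  rw [map_sum]
  refine Ideal.sum_mem _ fun j _ => ?_
  rw [lowering_apply]
  refine Ideal.sum_mem _ fun i _ => ?_
  have hmem : (X j : MvPolynomial σ K) ^ (b + 1) ∈ powIdeal K (b + 1) Finset.univ :=
    Ideal.subset_span ⟨j, by simp, rfl⟩
  by_cases hij : i = j
  · subst hij
    have : (b : MvPolynomial σ K) * pderiv i (c i • X i ^ (b + 1)) -
        X i * pderiv i (pderiv i (c i • X i ^ (b + 1))) =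
        (-((b : MvPolynomial σ K) + 2) * pderiv i (c i) - X i * pderiv i (pderiv i (c i))) *
          X i ^ (b + 1) := by
      rcases b with _ | b
      · simp [Derivation.leibniz]
        ring
      · simp [Derivation.leibniz, Derivation.leibniz_pow]
        ring
    rw [this]
    exact Ideal.mul_mem_left _ _ hmem
  · have hz : pderiv i (X j : MvPolynomial σ K) = 0 := by
      rw [pderiv_X_of_ne (Ne.symm hij)]
    have : (b : MvPolynomial σ K) * pderiv i (c j • X j ^ (b + 1)) -
        X i * pderiv i (pderiv i (c j • X j ^ (b + 1))) =
        ((b : MvPolynomial σ K) * pderiv i (c j) - X i * pderiv i (pderiv i (c j))) *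
          X j ^ (b + 1) := by
      simp [Derivation.leibniz, Derivation.leibniz_pow, hz]
      ring
    rw [this]
    exact Ideal.mul_mem_left _ _ hmem

end PowIdeal

section PowIdealLefschetz

variable {σ K : Type*} [Fintype σ] [DecidableEq σ] [Field K]

/-- The quotient map by the ideal of `(b + 1)`-st powers of all the variables, as a `K`-linear
map. -/
abbrev powMkQ (σ K : Type*) [Fintype σ] [Field K] (b : ℕ) :=
  ((powIdeal K (b + 1) (Finset.univ : Finset σ)).restrictScalars K).mkQ

omit [DecidableEq σ] in
theorem powMkQ_eq_zero_iff {b : ℕ} {p : MvPolynomial σ K} :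
    powMkQ σ K b p = 0 ↔ p ∈ powIdeal K (b + 1) Finset.univ := by
  rw [← LinearMap.mem_ker, Submodule.ker_mkQ, Submodule.restrictScalars_mem]

omit [DecidableEq σ] in
theorem powIdeal_le_comap_mulLeft (b : ℕ) (g : MvPolynomial σ K) :
    (powIdeal K (b + 1) (Finset.univ : Finset σ)).restrictScalars K ≤
      ((powIdeal K (b + 1) (Finset.univ : Finset σ)).restrictScalars K).comap
        (LinearMap.mulLeft K g) :=
  fun _ hp => Ideal.mul_mem_left _ _ hp

omit [DecidableEq σ] in
theorem powIdeal_le_comap_lowering (b : ℕ) (T : Finset σ) :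
    (powIdeal K (b + 1) (Finset.univ : Finset σ)).restrictScalars K ≤
      ((powIdeal K (b + 1) (Finset.univ : Finset σ)).restrictScalars K).comap (lowering K b T) :=
  fun _ hp => lowering_mem_powIdeal b T hp

/-- Multiplication by `sumX K T` on the quotient by the `(b + 1)`-st powers of the variables. -/
def raiseQ (b : ℕ) (T : Finset σ) :
    Module.End K (MvPolynomial σ K ⧸
      (powIdeal K (b + 1) (Finset.univ : Finset σ)).restrictScalars K) :=
  Submodule.mapQ _ _ (LinearMap.mulLeft K (sumX K T)) (powIdeal_le_comap_mulLeft b _)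

/-- The operator induced by `lowering K b T` on the quotient by the `(b + 1)`-st powers of the
variables. -/
def lowerQ (b : ℕ) (T : Finset σ) :
    Module.End K (MvPolynomial σ K ⧸
      (powIdeal K (b + 1) (Finset.univ : Finset σ)).restrictScalars K) :=
  Submodule.mapQ _ _ (lowering K b T) (powIdeal_le_comap_lowering b T)

omit [DecidableEq σ] in
theorem raiseQ_powMkQ (b : ℕ) (T : Finset σ) (p : MvPolynomial σ K) :
    raiseQ b T (powMkQ σ K b p) = powMkQ σ K b (sumX K T * p) := rfl

omit [DecidableEq σ] in
theorem raiseQ_pow_powMkQ (b : ℕ) (T : Finset σ) (k : ℕ) (p : MvPolynomial σ K) :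
    (raiseQ b T ^ k) (powMkQ σ K b p) = powMkQ σ K b (sumX K T ^ k * p) := by
  induction k with
  | zero => simp
  | succ k ih =>
    rw [pow_succ', Module.End.mul_apply, ih, raiseQ_powMkQ, ← mul_assoc, ← pow_succ']

/-- The bigraded pieces of the quotient by the `(b + 1)`-st powers of the variables. -/
def pieceQ (b : ℕ) (T U : Finset σ) (i j : ℕ) : Submodule K (MvPolynomial σ K ⧸
    (powIdeal K (b + 1) (Finset.univ : Finset σ)).restrictScalars K) :=
  (weightedHomogeneousSubmodule K (indWeight T) i ⊓
    weightedHomogeneousSubmodule K (indWeight U) j).map (powMkQ σ K b)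

theorem pieceQ_comm (b : ℕ) (T U : Finset σ) (i j : ℕ) :
    (pieceQ b T U i j : Submodule K _) = pieceQ b U T j i := by
  rw [pieceQ, pieceQ, inf_comm]

theorem isLefschetz_raiseQ (b : ℕ) {T U : Finset σ} (hTU : Disjoint T U) (j : ℕ) :
    IsLefschetz (raiseQ b T) (lowerQ b T) (fun i => (pieceQ b T U i j : Submodule K _))
      (b * T.card) :=
  (isLefschetz_sumX b hTU j).mapQ _ (powIdeal_le_comap_mulLeft b _)
    (powIdeal_le_comap_lowering b T)

theorem mem_powIdeal_of_sumX_mul_mem [CharZero K] {b e : ℕ} {z : MvPolynomial σ K}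
    (hz : z.IsHomogeneous e) (he : 2 * e + 1 ≤ b * Fintype.card σ)
    (h : sumX K Finset.univ * z ∈ powIdeal K (b + 1) Finset.univ) :
    z ∈ powIdeal K (b + 1) Finset.univ := by
  have hL := isLefschetz_raiseQ (K := K) b (Finset.disjoint_empty_right (Finset.univ : Finset σ)) 0
  rw [← powMkQ_eq_zero_iff] at h ⊢
  refine hL.eq_zero_of_pow_eq_zero (j := e) (k := 1) he ⟨z, ⟨?_, ?_⟩, rfl⟩ ?_
  · have : indWeight (Finset.univ : Finset σ) = 1 := by ext; simp [indWeight]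
    simpa [this] using hz
  · intro m _
    simp [indWeight, Finsupp.weight_apply]
  · rw [raiseQ_pow_powMkQ, pow_one, h]

theorem weight_indWeight_add_compl (T : Finset σ) (m : σ →₀ ℕ) :
    Finsupp.weight (indWeight T) m + Finsupp.weight (indWeight Tᶜ) m = Finsupp.weight 1 m := by
  rw [Finsupp.weight_apply, Finsupp.weight_apply, Finsupp.weight_apply, ← Finsupp.sum_add]
  refine Finsupp.sum_congr fun i _ => ?_
  by_cases hi : i ∈ T <;> simp [indWeight, hi]

theorem weightedHomogeneousComponent_indWeight_mem (T : Finset σ) {p : MvPolynomial σ K} {e : ℕ}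
    (hp : p.IsHomogeneous e) {i : ℕ} (hi : i ≤ e) :
    weightedHomogeneousComponent (indWeight T) i p ∈
      weightedHomogeneousSubmodule K (indWeight T) i ⊓
        weightedHomogeneousSubmodule K (indWeight Tᶜ) (e - i) := by
  refine ⟨weightedHomogeneousComponent_isWeightedHomogeneous _ _, fun m hm => ?_⟩
  rw [coeff_weightedHomogeneousComponent] at hm
  split_ifs at hm with h
  · have h1 := weight_indWeight_add_compl T m
    have h2 : Finsupp.weight 1 m = e := hp hm
    omega
  · exact absurd rfl hm

theorem weightedHomogeneousComponent_indWeight_eq_zero (T : Finset σ) {p : MvPolynomial σ K}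
    {e : ℕ} (hp : p.IsHomogeneous e) {i : ℕ} (hi : e < i) :
    weightedHomogeneousComponent (indWeight T) i p = 0 := by
  refine weightedHomogeneousComponent_eq_zero' _ _ fun m hm => ?_
  have h1 := weight_indWeight_add_compl T m
  have h2 : Finsupp.weight 1 m = e := hp (mem_support_iff.mp hm)
  omega

theorem sum_weightedHomogeneousComponent_indWeight (T : Finset σ) {p : MvPolynomial σ K}
    {e : ℕ} (hp : p.IsHomogeneous e) :
    ∑ i ∈ Finset.range (e + 1), weightedHomogeneousComponent (indWeight T) i p = p := by
  conv_rhs => rw [← sum_weightedHomogeneousComponent (indWeight T) p]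
  refine (finsum_eq_sum_of_support_subset _ fun i hi => ?_).symm
  by_contra h
  simp only [Finset.coe_range, Set.mem_Iio, not_lt] at h
  exact hi (weightedHomogeneousComponent_indWeight_eq_zero T hp h)

theorem exists_sub_sumX_mul_mem_powIdeal [CharZero K] {b k : ℕ} {T : Finset σ}
    (hT : 3 * k + 4 ≤ b * T.card) (hU : 3 * k + 4 ≤ b * Tᶜ.card)
    {p v : MvPolynomial σ K} (hp : p.IsHomogeneous (k + 2)) (hv : v.IsHomogeneous (2 * k + 1))
    (h : sumX K Tᶜ ^ k * p - sumX K Finset.univ * v ∈ powIdeal K (b + 1) Finset.univ) :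
    ∃ t, p - sumX K Finset.univ * t ∈ powIdeal K (b + 1) Finset.univ := by
  have hsum : sumX K (Finset.univ : Finset σ) = sumX K T + sumX K Tᶜ :=
    (Finset.sum_add_sum_compl T _).symm
  have hdisj : Disjoint Tᶜ T := disjoint_compl_left
  have hT0 : (sumX K Tᶜ).IsWeightedHomogeneous (indWeight T) 0 :=
    sumX_isWeightedHomogeneous_of_disjoint hdisj
  have hTk : (sumX K Tᶜ ^ k).IsWeightedHomogeneous (indWeight T) 0 := by
    simpa using hT0.pow k
  have hcomp (i : ℕ) := weightedHomogeneousComponent_mem_powIdeal (indWeight T) h i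
  have hE : Commute (raiseQ (K := K) b T) (raiseQ b Tᶜ) := by
    ext q
    change powMkQ σ K b _ = powMkQ σ K b _
    simp only [LinearMap.mulLeft_apply]
    rw [mul_left_comm]
  have hF : Commute (lowerQ (K := K) b T) (raiseQ b Tᶜ) := by
    refine LinearMap.ext fun q => ?_
    obtain ⟨q, rfl⟩ := Submodule.mkQ_surjective _ q
    change powMkQ σ K b (lowering K b T (sumX K Tᶜ * q)) =
      powMkQ σ K b (sumX K Tᶜ * lowering K b T q)
    rw [lowering_sumX_mul_of_disjoint _ hdisj.symm]
  obtain ⟨t, ht⟩ := exists_sum_eq_of_pow_eq (D := fun i j => pieceQ b T Tᶜ i j)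
    (E₁ := raiseQ b T) (F₁ := lowerQ b T) (E₂ := raiseQ b Tᶜ) (F₂ := lowerQ b Tᶜ)
    (fun j => isLefschetz_raiseQ b hdisj.symm j)
    (fun i => by simpa only [pieceQ_comm b T] using isLefschetz_raiseQ (K := K) b hdisj i)
    hE hF hT hU
    (p := fun i => powMkQ σ K b (weightedHomogeneousComponent (indWeight T) i p))
    (v := fun i => powMkQ σ K b (weightedHomogeneousComponent (indWeight T) i v))
    (fun i hi => ⟨_, weightedHomogeneousComponent_indWeight_mem T hp hi, rfl⟩)
    (fun i hi => by rw [weightedHomogeneousComponent_indWeight_eq_zero T hp hi, map_zero])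
    (fun i hi => ⟨_, weightedHomogeneousComponent_indWeight_mem T hv hi, rfl⟩)
    (fun i hi => by rw [weightedHomogeneousComponent_indWeight_eq_zero T hv hi, map_zero])
    (by
      have := hcomp 0
      rw [hsum, add_mul, map_sub, map_add,
        weightedHomogeneousComponent_mul_of_isWeightedHomogeneous_zero hTk,
        weightedHomogeneousComponent_mul_of_isWeightedHomogeneous_zero hT0,
        weightedHomogeneousComponent_mul_of_lt (sumX_isWeightedHomogeneous T) _ zero_lt_one,
        zero_add, ← powMkQ_eq_zero_iff, map_sub, sub_eq_zero] at this
      rw [raiseQ_pow_powMkQ, raiseQ_powMkQ, this])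
    (fun i => by
      have := hcomp (i + 1)
      rw [hsum, add_mul, map_sub, map_add,
        weightedHomogeneousComponent_mul_of_isWeightedHomogeneous_zero hTk,
        weightedHomogeneousComponent_mul_of_isWeightedHomogeneous_zero hT0, add_comm i 1,
        weightedHomogeneousComponent_mul_add (sumX_isWeightedHomogeneous T),
        ← powMkQ_eq_zero_iff, map_sub, sub_eq_zero] at this
      rw [raiseQ_pow_powMkQ, raiseQ_powMkQ, raiseQ_powMkQ, ← map_add, add_comm i 1, this])
  obtain ⟨t, rfl⟩ := Submodule.mkQ_surjective _ t
  refine ⟨t, ?_⟩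
  rw [← map_sum, sum_weightedHomogeneousComponent_indWeight T hp] at ht
  rw [← powMkQ_eq_zero_iff, map_sub, sub_eq_zero, ht, hsum, add_mul, map_add]
  rfl

end PowIdealLefschetz

section Koszul

variable {σ ι K : Type*} [Field K]

theorem exists_isHomogeneous_coeff {g : ι → MvPolynomial σ K} {e : ι → ℕ}
    (hg : ∀ i, (g i).IsHomogeneous (e i)) {N : ℕ} (he : ∀ i, e i ≤ N) {s : Finset ι}
    {z : MvPolynomial σ K} (hz : z.IsHomogeneous N) (h : z ∈ Ideal.span (g '' (s : Set ι))) :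
    ∃ c : ι → MvPolynomial σ K, (∀ i, (c i).IsHomogeneous (N - e i)) ∧
      z = ∑ i ∈ s, c i * g i := by
  obtain ⟨c, hc⟩ := (Submodule.mem_span_image_finset_iff_exists_fun' _).mp h
  refine ⟨fun i => weightedHomogeneousComponent 1 (N - e i) (c i),
    fun i => weightedHomogeneousComponent_isWeightedHomogeneous _ _, ?_⟩
  have hz' : weightedHomogeneousComponent 1 N z = z :=
    (weightedHomogeneousComponent_of_mem hz).trans (if_pos rfl)
  rw [← hz', ← hc, map_sum]
  refine Finset.sum_congr rfl fun i _ => ?_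
  rw [smul_eq_mul, mul_comm, mul_comm _ (g i), ← weightedHomogeneousComponent_mul_add (hg i),
    Nat.add_sub_cancel' (he i)]

/-- Exactness of the degree-`D` strand of the Koszul complex of the family `g`, restricted to
`s`, at its second term from the right. -/
def KoszulExact (g : ι → MvPolynomial σ K) (e : ι → ℕ) (D : ℕ) (s : Finset ι) : Prop :=
  ∀ z : ι → MvPolynomial σ K, (∀ i, (z i).IsHomogeneous (D - e i)) → ∑ i ∈ s, z i * g i = 0 →
    ∃ a : ι → ι → MvPolynomial σ K, (∀ i j, (a i j).IsHomogeneous (D - e i - e j)) ∧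
      ∀ i ∈ s, z i = ∑ j ∈ s, (a i j - a j i) * g j

theorem koszulExact_empty (g : ι → MvPolynomial σ K) (e : ι → ℕ) (D : ℕ) :
    KoszulExact g e D ∅ :=
  fun _ _ _ => ⟨0, fun _ _ => isHomogeneous_zero _ _ _, by simp⟩

theorem KoszulExact.insert [DecidableEq ι] {g : ι → MvPolynomial σ K} {e : ι → ℕ} {D : ℕ}
    {s : Finset ι} (h : KoszulExact g e D s) (hg : ∀ i, (g i).IsHomogeneous (e i))
    (he : ∀ i j, e i + e j ≤ D) {k : ι} (hk : k ∉ s)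
    (hreg : ∀ z : MvPolynomial σ K, z.IsHomogeneous (D - e k) →
      z * g k ∈ Ideal.span (g '' (s : Set ι)) → z ∈ Ideal.span (g '' (s : Set ι))) :
    KoszulExact g e D (insert k s) := by
  intro z hz hsum
  rw [Finset.sum_insert hk] at hsum
  have hzk : z k ∈ Ideal.span (g '' (s : Set ι)) := by
    refine hreg _ (hz k) ?_
    rw [eq_neg_of_add_eq_zero_left hsum]
    exact neg_mem (Ideal.sum_mem _ fun i hi =>
      Ideal.mul_mem_left _ _ (Ideal.subset_span ⟨i, hi, rfl⟩))
  obtain ⟨c, hc, hzc⟩ := exists_isHomogeneous_coeff hg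
    (fun i => Nat.le_sub_of_add_le (he i k)) (hz k) hzk
  obtain ⟨a, ha, hza⟩ := h (fun i => z i + c i * g k) (fun i => (hz i).add (by
    have := (hc i).mul (hg k)
    have h1 := he i k
    rwa [show D - e k - e i + e k = D - e i by omega] at this)) (by
    rw [hzc, Finset.sum_mul] at hsum
    rw [← hsum, ← Finset.sum_add_distrib]
    exact Finset.sum_congr rfl fun i _ => by ring)
  refine ⟨fun i j => if j = k then 0 else if i = k then c j else a i j, fun i j => ?_,
    fun i hi => ?_⟩
  · dsimp only
    split_ifs with h1 h2
    · exact isHomogeneous_zero _ _ _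
    · exact h2 ▸ hc j
    · exact ha i j
  · have hne : ∀ j ∈ s, j ≠ k := fun j hj hjk => hk (hjk ▸ hj)
    rw [Finset.sum_insert hk]
    obtain rfl | his := Finset.mem_insert.mp hi
    · rw [hzc]
      simp only [if_true, sub_self, zero_mul, zero_add]
      refine Finset.sum_congr rfl fun j hj => ?_
      simp [hne j hj]
    · have hsub : ∑ j ∈ s, (a i j - a j i) * g j =
          ∑ j ∈ s, ((if j = k then 0 else if i = k then c j else a i j) -
            if i = k then 0 else if j = k then c i else a j i) * g j :=
        Finset.sum_congr rfl fun j hj => by simp [hne j hj, hne i his]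
      rw [← hsub, eq_sub_of_add_eq (hza i his)]
      simp only [if_true, if_neg (hne i his)]
      ring

/-- The family consisting of `Q`, `x` and the `u i`. -/
def consFamily {R : Type*} (Q x : R) (u : σ → R) : Option (Option σ) → R :=
  fun i => i.elim Q fun i => i.elim x u

theorem koszulExact_powers [Fintype σ] [DecidableEq σ] [CharZero K] {b : ℕ} (hb : 4 ≤ b)
    {T : Finset σ} (hT : 5 ≤ T.card) (hU : 5 ≤ Tᶜ.card) :
    KoszulExact (consFamily (sumX K Tᶜ ^ (b + 1)) (sumX K Finset.univ) fun i => X i ^ (b + 1))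
      (consFamily (b + 1) 1 fun _ : σ => b + 1) (2 * (b + 2)) Finset.univ := by
  set g := consFamily (sumX K Tᶜ ^ (b + 1)) (sumX K Finset.univ) fun i => X i ^ (b + 1) with hgdef
  set e := consFamily (b + 1) 1 fun _ : σ => b + 1 with hedef
  have hX (U : Finset σ) : (sumX K U).IsHomogeneous 1 :=
    sumX_isWeightedHomogeneous_of_forall fun _ _ => rfl
  have hg : ∀ i, (g i).IsHomogeneous (e i)
    | none => by
      have := (hX Tᶜ).pow (b + 1)
      rwa [one_mul] at this
    | some none => hX _
    | some (some i) => isHomogeneous_X_pow i (b + 1)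
  have he1 : ∀ i, e i ≤ b + 1
    | none => le_rfl
    | some none => Nat.le_add_left 1 b
    | some (some i) => le_rfl
  have he (i j) : e i + e j ≤ 2 * (b + 2) := by
    have := he1 i
    have := he1 j
    omega
  let emb : σ ↪ Option (Option σ) := Function.Embedding.some.trans Function.Embedding.some
  have hspan (U : Finset σ) :
      Ideal.span (g '' (U.map emb : Finset _)) = powIdeal K (b + 1) U := by
    rw [Finset.coe_map, Set.image_image]
    rfl
  have hpow (U : Finset σ) : KoszulExact g e (2 * (b + 2)) (U.map emb) := by
    induction U using Finset.induction_on with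
    | empty => exact koszulExact_empty _ _ _
    | insert i U hi ih =>
      rw [Finset.map_insert]
      refine ih.insert hg he (by simpa using hi) fun z _ hz => ?_
      rw [hspan] at hz ⊢
      exact mem_powIdeal_of_mul_X_pow_mem hi hz
  have hcard : T.card + Tᶜ.card = Fintype.card σ := Finset.card_add_card_compl T
  have hx := (hpow Finset.univ).insert hg he (k := some none) (by simp [emb]) fun z hz h => by
    rw [hspan] at h ⊢
    refine mem_powIdeal_of_sumX_mul_mem hz ?_ (mul_comm z _ ▸ h)
    change 2 * (2 * (b + 2) - 1) + 1 ≤ _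
    have : b * 10 ≤ b * Fintype.card σ := Nat.mul_le_mul_left _ (by omega)
    omega
  have hQ := hx.insert hg he (k := none) (by simp [emb]) fun z hz h => by
    rw [Finset.coe_insert, Set.image_insert_eq, Ideal.span_insert, hspan]
    have hN : ∀ i, e i ≤ 2 * (b + 2) := fun i => (Nat.le_add_right _ _).trans (he i i)
    have hzQ : (z * g none).IsHomogeneous (2 * (b + 2)) := by
      have := hz.mul (hg none)
      rwa [Nat.sub_add_cancel (hN none)] at this
    obtain ⟨c, hc, hzc⟩ := exists_isHomogeneous_coeff hg hN hzQ h
    rw [Finset.sum_insert (by simp [emb])] at hzc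
    have hmem : sumX K Tᶜ ^ (b + 1) * z - sumX K Finset.univ * c (some none) ∈
        powIdeal K (b + 1) Finset.univ := by
      have : sumX K Tᶜ ^ (b + 1) * z - sumX K Finset.univ * c (some none) =
          z * g none - c (some none) * g (some none) := by
        simp only [hgdef, consFamily, Option.elim]
        ring
      rw [this, hzc, add_sub_cancel_left, ← hspan]
      exact Ideal.sum_mem _ fun i hi =>
        Ideal.mul_mem_left _ _ (Ideal.subset_span ⟨i, hi, rfl⟩)
    have hz' : z.IsHomogeneous (b + 1 + 2) := by
      have : 2 * (b + 2) - e none = b + 1 + 2 := by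
        simp only [hedef, consFamily, Option.elim]
        omega
      rwa [this] at hz
    have hv' : (c (some none)).IsHomogeneous (2 * (b + 1) + 1) := hc (some none)
    have h5 : b * 5 ≤ b * T.card := Nat.mul_le_mul_left _ hT
    have h5' : b * 5 ≤ b * Tᶜ.card := Nat.mul_le_mul_left _ hU
    obtain ⟨t, ht⟩ := exists_sub_sumX_mul_mem_powIdeal (by omega) (by omega) hz' hv' hmem
    have := Ideal.add_mem _ (Ideal.mem_sup_right ht)
      (Ideal.mem_sup_left (Ideal.mul_mem_right t _ (Ideal.mem_span_singleton_self (g (some none)))))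
    simpa only [hgdef, consFamily, Option.elim, sub_add_cancel] using this
  convert hQ
  ext i
  rcases i with _ | _ | i <;> simp [emb]

end Koszul

section PolyFun

variable {M N : Type} [AddCommGroup M] [Module ℂ M] [AddCommGroup N] [Module ℂ N]

theorem isPolyFun_linear (l : M →ₗ[ℂ] ℂ) : IsPolyFun fun y => l y :=
  Algebra.subset_adjoin ⟨l, rfl⟩

theorem isPolyFun_const (c : ℂ) : IsPolyFun fun _ : M => c :=
  Subalgebra.algebraMap_mem _ c

theorem IsPolyFun.mul {φ ψ : M → ℂ} (hφ : IsPolyFun φ) (hψ : IsPolyFun ψ) :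
    IsPolyFun fun y => φ y * ψ y :=
  Subalgebra.mul_mem _ hφ hψ

theorem IsPolyFun.add {φ ψ : M → ℂ} (hφ : IsPolyFun φ) (hψ : IsPolyFun ψ) :
    IsPolyFun fun y => φ y + ψ y :=
  Subalgebra.add_mem _ hφ hψ

theorem IsPolyFun.comp_affine {φ : N → ℂ} (hφ : IsPolyFun φ) (l : M →ₗ[ℂ] N) (c : N) :
    IsPolyFun fun y => φ (l y + c) := by
  induction hφ using Algebra.adjoin_induction with
  | mem _ h =>
    obtain ⟨m, rfl⟩ := h
    simp only [map_add]
    exact (isPolyFun_linear (m ∘ₗ l)).add (isPolyFun_const _)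
  | algebraMap r => exact isPolyFun_const r
  | add φ ψ _ _ h₁ h₂ => exact h₁.add h₂
  | mul φ ψ _ _ h₁ h₂ => exact h₁.mul h₂

theorem isPolyFun_matrix_det {κ : Type*} [Fintype κ] [DecidableEq κ] {A : M → Matrix κ κ ℂ}
    (hA : ∀ i j, IsPolyFun fun y => A y i j) : IsPolyFun fun y => (A y).det := by
  have h : (fun y => (A y).det) =
      ∑ s : Equiv.Perm κ, (Equiv.Perm.sign s : ℤ) • ∏ i, fun y => A y (s i) i := by
    ext y
    simp [Matrix.det_apply, Finset.sum_apply, Finset.prod_apply, Units.smul_def]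
  rw [h]
  exact Subalgebra.sum_mem _ fun s _ => Subalgebra.zsmul_mem _
    (Subalgebra.prod_mem _ fun i _ => hA _ _) _

theorem isPolyFun_det {B : Type*} [AddCommGroup B] [Module ℂ B] [FiniteDimensional ℂ B]
    (L : M →ₗ[ℂ] Module.End ℂ B) (c : Module.End ℂ B) :
    IsPolyFun fun y => LinearMap.det (L y + c) := by
  classical
  let b := Module.finBasis ℂ B
  simp only [← LinearMap.det_toMatrix b]
  refine isPolyFun_matrix_det fun i j => ?_
  have (y : M) : LinearMap.toMatrix b b (L y + c) i j =
      (b.coord i ∘ₗ LinearMap.applyₗ (b j) ∘ₗ L) y + b.coord i (c (b j)) := by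
    simp [LinearMap.toMatrix_apply]
  simp only [this]
  exact (isPolyFun_linear _).add (isPolyFun_const _)

/-- Exactness of a linear family of complexes `A → B → C` of vector spaces with `B`
finite-dimensional is a Zariski-open condition. -/
theorem exists_isPolyFun_of_exact {A B C : Type*} [AddCommGroup A] [Module ℂ A] [AddCommGroup B]
    [Module ℂ B] [FiniteDimensional ℂ B] [AddCommGroup C] [Module ℂ C] (α : M →ₗ[ℂ] A →ₗ[ℂ] B)
    (β : M →ₗ[ℂ] B →ₗ[ℂ] C) (hβα : ∀ y a, β y (α y a) = 0) (y₀ : M)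
    (h₀ : ∀ b, β y₀ b = 0 → ∃ a, α y₀ a = b) :
    ∃ Φ : M → ℂ, IsPolyFun Φ ∧ Φ y₀ ≠ 0 ∧ ∀ y, Φ y ≠ 0 → ∀ b, β y b = 0 → ∃ a, α y a = b := by
  obtain ⟨s, hs⟩ := (α y₀).rangeRestrict.exists_rightInverse_of_surjective
    (LinearMap.range_rangeRestrict _)
  have hle : LinearMap.ker (β y₀) ≤ LinearMap.range (α y₀) := h₀
  obtain ⟨π, hπ⟩ := (LinearMap.ker (β y₀)).subtype.exists_leftInverse_of_injective
    (Submodule.ker_subtype _)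
  let P : Module.End ℂ B := (LinearMap.ker (β y₀)).subtype ∘ₗ π
  have hPker (b : B) : β y₀ (P b) = 0 := (π b).2
  have hP (b : B) (hb : β y₀ b = 0) : P b = b :=
    congrArg Subtype.val (LinearMap.congr_fun hπ ⟨b, hb⟩)
  let u : B →ₗ[ℂ] A := s ∘ₗ Submodule.inclusion hle ∘ₗ π
  have hu (b : B) : α y₀ (u b) = P b :=
    congrArg Subtype.val (LinearMap.congr_fun hs (Submodule.inclusion hle (π b)))
  obtain ⟨G, hG⟩ : ∃ G : C →ₗ[ℂ] B, G ∘ₗ β y₀ = LinearMap.id - P := by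
    obtain ⟨r, hr⟩ := ((LinearMap.ker (β y₀)).liftQ (β y₀) le_rfl).exists_leftInverse_of_injective
      (Submodule.ker_liftQ_eq_bot _ _ _ le_rfl)
    refine ⟨(LinearMap.ker (β y₀)).liftQ (LinearMap.id - P) (fun b hb => ?_) ∘ₗ r,
      LinearMap.ext fun b => ?_⟩
    · simp [hP b hb]
    · have h1 : r (β y₀ b) = Submodule.Quotient.mk b :=
        LinearMap.congr_fun hr (Submodule.Quotient.mk b)
      simp only [LinearMap.comp_apply, h1]
      rfl
  let Θ : M →ₗ[ℂ] Module.End ℂ B := (LinearMap.lcomp ℂ B u) ∘ₗ α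
  let Ψ : M →ₗ[ℂ] Module.End ℂ B :=
    (LinearMap.llcomp ℂ B C B G) ∘ₗ (LinearMap.lcomp ℂ C (LinearMap.id - P)) ∘ₗ β
  have hΘ (y : M) (b : B) : Θ y b = α y (u b) := rfl
  have hΨ (y : M) (b : B) : Ψ y b = G (β y (b - P b)) := rfl
  have hG' (b : B) : G (β y₀ b) = b - P b := LinearMap.congr_fun hG b
  refine ⟨fun y => LinearMap.det (Θ y + (LinearMap.id - P)) * LinearMap.det (Ψ y + P),
    (isPolyFun_det _ _).mul (isPolyFun_det _ _), ?_, fun y hy b hb => ?_⟩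
  · have h1 : Θ y₀ + (LinearMap.id - P) = LinearMap.id := by
      ext b
      simp [hΘ, hu]
    have h2 : Ψ y₀ + P = LinearMap.id := by
      ext b
      simp [hΨ, hG', hPker]
    simp [h1, h2]
  · have h1 : IsUnit (Θ y + (LinearMap.id - P)) :=
      LinearMap.isUnit_iff_isUnit_det _ |>.mpr (left_ne_zero_of_mul hy).isUnit
    have h2 : IsUnit (Ψ y + P) :=
      LinearMap.isUnit_iff_isUnit_det _ |>.mpr (right_ne_zero_of_mul hy).isUnit
    obtain ⟨c, rfl⟩ := ((Module.End.isUnit_iff _).mp h1).surjective b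
    have hc : c - P c = 0 := by
      refine ((Module.End.isUnit_iff _).mp h2).injective ?_
      have h3 : β y (c - P c) = 0 := by simpa [hΘ, hβα] using hb
      have h4 : P (c - P c) = 0 := by rw [map_sub, hP (P c) (hPker c), sub_self]
      rw [map_zero, LinearMap.add_apply, hΨ, h4, sub_zero, h3, map_zero, add_zero]
    exact ⟨u c, by simp [hΘ, hc]⟩

end PolyFun

section KoszulOpen

variable {M : Type} [AddCommGroup M] [Module ℂ M] {σ ι : Type*} [Finite σ] [Fintype ι]

instance (k : ℕ) : FiniteDimensional ℂ (homogeneousSubmodule σ ℂ k) :=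
  Module.Finite.iff_fg.mpr (homogeneousSubmodule_fg σ ℂ k)

theorem exists_isPolyFun_koszulExact (g : M →ₗ[ℂ] ι → MvPolynomial σ ℂ) {e : ι → ℕ} {D : ℕ}
    (hg : ∀ y i, (g y i).IsHomogeneous (e i)) (he : ∀ i j, e i + e j ≤ D) {y₀ : M}
    (h₀ : KoszulExact (g y₀) e D Finset.univ) :
    ∃ Φ : M → ℂ, IsPolyFun Φ ∧ Φ y₀ ≠ 0 ∧
      ∀ y, Φ y ≠ 0 → KoszulExact (g y) e D Finset.univ := by
  let H (k : ℕ) := homogeneousSubmodule σ ℂ k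
  have hmem (y : M) (a : ∀ i j, H (D - e i - e j)) (i : ι) :
      ∑ j, ((a i j : MvPolynomial σ ℂ) - a j i) * g y j ∈ H (D - e i) := by
    refine Submodule.sum_mem _ fun j _ => ?_
    have h1 := he i j
    have h2 : (a j i : MvPolynomial σ ℂ).IsHomogeneous (D - e i - e j) := by
      have := (mem_homogeneousSubmodule _ _).mp (a j i).2
      convert this using 1
      omega
    have := ((a i j).2.sub h2).mul (hg y j)
    rwa [Nat.sub_add_cancel (by omega)] at this
  let α : M →ₗ[ℂ] (∀ i j, H (D - e i - e j)) →ₗ[ℂ] ∀ i, H (D - e i) :=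
    LinearMap.mk₂ ℂ (fun y a i => ⟨_, hmem y a i⟩)
      (fun y y' a => by ext1 i; ext1; simp [mul_add, Finset.sum_add_distrib])
      (fun c y a => by ext1 i; ext1; simp [Finset.smul_sum])
      (fun y a a' => by
        ext1 i; ext1
        simp only [Pi.add_apply, Submodule.coe_add, ← Finset.sum_add_distrib]
        exact Finset.sum_congr rfl fun j _ => by ring)
      (fun c y a => by ext1 i; ext1; simp [Finset.smul_sum, ← smul_sub])
  let β : M →ₗ[ℂ] (∀ i, H (D - e i)) →ₗ[ℂ] MvPolynomial σ ℂ :=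
    LinearMap.mk₂ ℂ (fun y z => ∑ i, (z i : MvPolynomial σ ℂ) * g y i)
      (fun y y' z => by simp [mul_add, Finset.sum_add_distrib])
      (fun c y z => by simp [Finset.smul_sum])
      (fun y z z' => by simp [add_mul, Finset.sum_add_distrib])
      (fun c y z => by simp [Finset.smul_sum])
  have hβα (y : M) (a : ∀ i j, H (D - e i - e j)) : β y (α y a) = 0 := by
    change ∑ i, (∑ j, ((a i j : MvPolynomial σ ℂ) - a j i) * g y j) * g y i = 0
    simp only [Finset.sum_mul, sub_mul, Finset.sum_sub_distrib]
    rw [sub_eq_zero, Finset.sum_comm]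
    exact Finset.sum_congr rfl fun i _ => Finset.sum_congr rfl fun j _ => by ring
  obtain ⟨Φ, hΦ, hΦ₀, h⟩ := exists_isPolyFun_of_exact α β hβα y₀ fun z hz => by
    obtain ⟨a, ha, haz⟩ := h₀ (fun i => z i) (fun i => (z i).2) hz
    exact ⟨fun i j => ⟨a i j, ha i j⟩,
      funext fun i => Subtype.ext (haz i (Finset.mem_univ i)).symm⟩
  refine ⟨Φ, hΦ, hΦ₀, fun y hy z hz hsum => ?_⟩
  obtain ⟨a, ha⟩ := h y hy (fun i => ⟨z i, hz i⟩) hsum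
  exact ⟨fun i j => a i j, fun i j => (a i j).2,
    fun i _ => congrArg Subtype.val (congrFun ha i).symm⟩

end KoszulOpen

section Generic

variable {n : ℕ}

theorem span_range_pderiv_eq_JX (f x : S n) :
    Ideal.span (Set.range fun i : Option (Fin (n + 1)) => i.elim x fun i => pderiv i f) =
      JX f x := by
  have : (Set.range fun i : Option (Fin (n + 1)) => i.elim x fun i => pderiv i f) =
      insert x (Set.range fun i => pderiv i f) := by
    ext p
    simp [Option.exists, eq_comm]
  rw [this, Ideal.span_insert, sup_comm, JX, jacobianIdeal]

theorem mem_JX_of_mul_mem {d : ℕ} (hd : 2 ≤ d) {f x Q p : S n} (hf : f.IsHomogeneous d)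
    (hx : x.IsHomogeneous 1) (hp : p.IsHomogeneous (d + 1)) (hQ : Q.IsHomogeneous (d - 1))
    (hK : KoszulExact (consFamily Q x fun i => pderiv i f)
      (consFamily (d - 1) 1 fun _ : Fin (n + 1) => d - 1) (2 * d) Finset.univ)
    (h : Q * p ∈ JX f x) : p ∈ JX f x := by
  let g : Option (Fin (n + 1)) → S n := fun i => i.elim x fun i => pderiv i f
  have hg : ∀ i, (g i).IsHomogeneous (i.elim 1 fun _ => d - 1)
    | none => hx
    | some i => hf.pderiv
  have hQp : (Q * p).IsHomogeneous (2 * d) := by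
    have := hQ.mul hp
    rwa [show d - 1 + (d + 1) = 2 * d by omega] at this
  have hspan : Ideal.span
      (g '' ((Finset.univ : Finset (Option (Fin (n + 1)))) : Set (Option (Fin (n + 1))))) =
      JX f x := by
    rw [Finset.coe_univ, Set.image_univ]
    exact span_range_pderiv_eq_JX f x
  obtain ⟨c, hc, hsum⟩ := exists_isHomogeneous_coeff hg (N := 2 * d)
    (fun i => by cases i <;> simp <;> omega) hQp (s := Finset.univ) (by rwa [hspan])
  obtain ⟨a, -, ha⟩ := hK (fun i => i.elim p fun i => -c i) (fun i => by
    match i with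
    | none =>
      change p.IsHomogeneous (2 * d - (d - 1))
      rwa [show 2 * d - (d - 1) = d + 1 by omega]
    | some none => exact (hc none).neg
    | some (some i) => exact (hc (some i)).neg) (by
    rw [Fintype.sum_option]
    change p * Q + ∑ i, -c i * g i = 0
    rw [mul_comm p Q, hsum, ← Finset.sum_add_distrib]
    exact Finset.sum_eq_zero fun i _ => by ring)
  have hpa := ha none (Finset.mem_univ _)
  rw [Fintype.sum_option, sub_self, zero_mul, zero_add] at hpa
  change p = ∑ i, (a none (some i) - a (some i) none) * g i at hpa
  rw [hpa, ← hspan]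
  exact Ideal.sum_mem _ fun i _ => Ideal.mul_mem_left _ _ (Ideal.subset_span ⟨i, by simp, rfl⟩)

/-- The triples consisting of a form of degree `d`, a linear form and a form of degree `d - 1`. -/
abbrev Triple (n d : ℕ) : Type :=
  homogeneousSubmodule (Fin (n + 1)) ℂ d × homogeneousSubmodule (Fin (n + 1)) ℂ 1 ×
    homogeneousSubmodule (Fin (n + 1)) ℂ (d - 1)

/-- The family `Q`, `x`, `∂f/∂X_i` as a linear function of the triple `(f, x, Q)`. -/
def tripleFamily (n d : ℕ) : Triple n d →ₗ[ℂ] Option (Option (Fin (n + 1))) → S n where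
  toFun y := consFamily y.2.2 y.2.1 fun i => pderiv i (y.1 : S n)
  map_add' y y' := by
    ext1 i
    rcases i with _ | _ | i <;> simp [consFamily]
  map_smul' c y := by
    ext1 i
    rcases i with _ | _ | i <;> simp [consFamily]

theorem tripleFamily_isHomogeneous {d : ℕ} (y : Triple n d) :
    ∀ i, (tripleFamily n d y i).IsHomogeneous (consFamily (d - 1) 1 (fun _ => d - 1) i)
  | none => y.2.2.2
  | some none => y.2.1.2
  | some (some _) => IsHomogeneous.pderiv y.1.2

theorem exists_koszulExact_tripleFamily {d : ℕ} (hd : 6 ≤ d) (hn : 9 ≤ n) :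
    ∃ y : Triple n d, KoszulExact (tripleFamily n d y)
      (consFamily (d - 1) 1 fun _ : Fin (n + 1) => d - 1) (2 * d) Finset.univ := by
  obtain ⟨b, rfl⟩ : ∃ b, d = b + 2 := ⟨d - 2, by omega⟩
  obtain ⟨T, -, hT⟩ := Finset.exists_subset_card_eq
    (show 5 ≤ (Finset.univ : Finset (Fin (n + 1))).card by simp; omega)
  have hU : 5 ≤ Tᶜ.card := by
    rw [Finset.card_compl, hT, Fintype.card_fin]
    omega
  have hX (U : Finset (Fin (n + 1))) : (sumX ℂ U).IsHomogeneous 1 :=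
    sumX_isWeightedHomogeneous_of_forall fun _ _ => rfl
  have hf : (∑ i : Fin (n + 1), C ((b + 2 : ℂ)⁻¹) * X i ^ (b + 2)).IsHomogeneous (b + 2) :=
    IsHomogeneous.sum _ _ _ fun i _ => (isHomogeneous_X_pow i _).C_mul _
  have hQ : (sumX ℂ Tᶜ ^ (b + 1)).IsHomogeneous (b + 1) := by
    have := (hX Tᶜ).pow (b + 1)
    rwa [one_mul] at this
  refine ⟨(⟨_, hf⟩, ⟨_, hX Finset.univ⟩, ⟨_, hQ⟩), ?_⟩
  have hpd (i : Fin (n + 1)) :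
      pderiv i (∑ i : Fin (n + 1), C ((b + 2 : ℂ)⁻¹) * X i ^ (b + 2)) = X i ^ (b + 1) := by
    have hb : (b + 2 : ℂ) ≠ 0 := by exact_mod_cast Nat.succ_ne_zero (b + 1)
    rw [map_sum, Finset.sum_eq_single i]
    · rw [pderiv_C_mul, pderiv_pow, pderiv_X_self]
      have : C ((b + 2 : ℂ)⁻¹) * ((b + 2 : ℕ) : S n) = 1 := by
        rw [← map_natCast (C : ℂ →+* S n), ← C_mul]
        push_cast
        rw [inv_mul_cancel₀ hb, C_1]
      simp only [mul_one]
      rw [← mul_assoc, this, one_mul]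
      rfl
    · intro j _ hj
      rw [pderiv_C_mul, pderiv_pow, pderiv_X_of_ne hj]
      simp
    · simp
  have := koszulExact_powers (K := ℂ) (b := b) (by omega) hT.ge hU
  simp only [← hpd] at this
  exact this

end Generic

/-- Claim: multiplication by a generic `q ∈ R_f^{d-1}` is injective.
For `d ≥ 6`, `n ≥ 9`, generic `f ∈ S^d`, generic linear form `x ∈ S¹` and generic
`q ∈ R_f^{d-1}`, multiplication by `q` from `R_f^{d+1}/x·R_f^d` to `R_f^{2d}/x·R_f^{2d-1}`
is injective: for a representative `Q` of `q` and any homogeneous `p` of degree `d+1`,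
`Q·p ∈ J_f + (x)` implies `p ∈ J_f + (x)`. -/
theorem generic_mult_by_q_injective (n d : ℕ) (hd : 6 ≤ d) (hn : 9 ≤ n) :
    GenericallyHolds (fun f : MvPolynomial.homogeneousSubmodule (Fin (n + 1)) ℂ d =>
      GenericallyHolds (fun x : MvPolynomial.homogeneousSubmodule (Fin (n + 1)) ℂ 1 =>
        GenericallyHolds (fun q : Rpiece (f : S n) (d - 1) =>
          ∀ Q : S n, Q.IsHomogeneous (d - 1) →
            Ideal.Quotient.mk (jacobianIdeal (f : S n)) Q = (q : S n ⧸ jacobianIdeal (f : S n)) →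
            ∀ p : S n, p.IsHomogeneous (d + 1) →
              Q * p ∈ JX (f : S n) (x : S n) → p ∈ JX (f : S n) (x : S n)))) := by
  obtain ⟨⟨f₀, x₀, Q₀⟩, h₀⟩ := exists_koszulExact_tripleFamily hd hn
  have he : ∀ i, consFamily (d - 1) 1 (fun _ : Fin (n + 1) => d - 1) i ≤ d - 1
    | none => le_rfl
    | some none => by
      change 1 ≤ d - 1
      omega
    | some (some i) => le_rfl
  obtain ⟨Φ, hΦ, hΦ₀, hK⟩ := exists_isPolyFun_koszulExact (tripleFamily n d)
    tripleFamily_isHomogeneous (fun i j => by have := he i; have := he j; omega) h₀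
  refine ⟨_, hΦ.comp_affine (LinearMap.inl ℂ _ _) (0, x₀, Q₀), ⟨f₀, by simpa using hΦ₀⟩,
    fun f hf => ?_⟩
  refine ⟨_, hΦ.comp_affine (LinearMap.inr ℂ _ _ ∘ₗ LinearMap.inl ℂ _ _) (f, 0, Q₀),
    ⟨x₀, by simpa using hf⟩, fun x hx => ?_⟩
  let π : homogeneousSubmodule (Fin (n + 1)) ℂ (d - 1) →ₗ[ℂ] Rpiece (f : S n) (d - 1) :=
    (Ideal.Quotient.mkₐ ℂ (jacobianIdeal (f : S n))).toLinearMap.submoduleMap _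
  obtain ⟨s, hs⟩ := π.exists_rightInverse_of_surjective
    (LinearMap.range_eq_top.mpr (LinearMap.submoduleMap_surjective _ _))
  have hs' (q) : π (s q) = q := LinearMap.congr_fun hs q
  refine ⟨_, hΦ.comp_affine (LinearMap.inr ℂ _ _ ∘ₗ LinearMap.inr ℂ _ _ ∘ₗ s)
    (f, x, Q₀ - s (π Q₀)), ⟨π Q₀, by simpa using hx⟩, fun q hq Q _ hQq p hp hQp => ?_⟩
  obtain ⟨Q', hΦQ', hπ⟩ : ∃ Q', Φ (f, x, Q') ≠ 0 ∧ π Q' = q :=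
    ⟨s q + (Q₀ - s (π Q₀)), by simpa using hq, by
      rw [map_add, map_sub, hs', hs', sub_self, add_zero]⟩
  have hsub : Q - Q' ∈ jacobianIdeal (f : S n) := by
    rw [← Ideal.Quotient.eq, hQq]
    exact congrArg Subtype.val hπ.symm
  have hK' : KoszulExact (consFamily (Q' : S n) (x : S n) fun i => pderiv i (f : S n))
      (consFamily (d - 1) 1 fun _ : Fin (n + 1) => d - 1) (2 * d) Finset.univ :=
    hK (f, x, Q') hΦQ'
  have hQ' : (Q' : S n).IsHomogeneous (d - 1) := Q'.2
  have hf' : (f : S n).IsHomogeneous d := f.2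
  have hx' : (x : S n).IsHomogeneous 1 := x.2
  have h2 : 2 ≤ d := by omega
  refine mem_JX_of_mul_mem h2 hf' hx' hp hQ' hK' ?_
  have := sub_mem hQp (Ideal.mul_mem_right p _ (Ideal.mem_sup_left hsub))
  rwa [← sub_mul, sub_sub_cancel] at this

end
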